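/- arXiv:1712.04728 — 2 statements merged into one kernel-verified Lean document; each statement's English description precedes it below -/
import Mathlib

section
/- Let A be a commutative ring, ℓ ∈ ℕ, and let C = ((J₀,U₀),…,(J_ℓ,U_ℓ)) be a family of ℓ+1 pairs of subsets of A. The following are equivalent: (a) there exists an increasing chain of prime ideals P₀ ⊆ P₁ ⊆ ⋯ ⊆ P_ℓ of A such that Jᵢ ⊆ Pᵢ and Uᵢ ∩ Pᵢ = ∅ for all i; (b) the chain C does not collapse, i.e., for all j₀,…,j_ℓ with jᵢ in the ideal generated by Jᵢ and all u₀,…,u_ℓ with uᵢ in the multiplicative submonoid generated by Uᵢ, one has u₀·(u₁·(⋯(u_ℓ + j_ℓ)⋯) + j₁) + j₀ ≠ 0. -/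
/-- The nested value `u₀·(u₁·(⋯(u_ℓ + j_ℓ)⋯) + j₁) + j₀` associated to
an idealistic chain of length `ℓ` (indices `0,…,ℓ`). -/
def chainVal {A : Type*} [CommRing A] (u j : ℕ → A) : ℕ → A
  | 0 => u 0 + j 0
  | n + 1 => u 0 * chainVal (fun i => u (i + 1)) (fun i => j (i + 1)) n + j 0

/-- An idealistic chain `((J₀,U₀),…,(J_ℓ,U_ℓ))` in a commutative ring collapses
if there are `jᵢ ∈ ⟨Jᵢ⟩` and `uᵢ ∈ M(Uᵢ)` with
`u₀·(u₁·(⋯(u_ℓ + j_ℓ)⋯) + j₁) + j₀ = 0`. -/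
def ChainCollapses {A : Type*} [CommRing A] (J U : ℕ → Set A) (ℓ : ℕ) : Prop :=
  ∃ j u : ℕ → A, (∀ i ≤ ℓ, j i ∈ Ideal.span (J i)) ∧
    (∀ i ≤ ℓ, u i ∈ Submonoid.closure (U i)) ∧ chainVal u j ℓ = 0

/-- The submonoid `M + I` of all elements congruent modulo `I` to an element of `M`. -/
def Submonoid.addIdeal {A : Type*} [CommRing A] (M : Submonoid A) (I : Ideal A) : Submonoid A :=
  (M.map (Ideal.Quotient.mk I)).comap (Ideal.Quotient.mk I)

theorem Submonoid.mem_addIdeal {A : Type*} [CommRing A] {M : Submonoid A} {I : Ideal A} {a : A} :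
    a ∈ M.addIdeal I ↔ ∃ m ∈ M, ∃ i ∈ I, a = m + i := by
  simp only [Submonoid.addIdeal, Submonoid.mem_comap, Submonoid.mem_map]
  constructor
  · rintro ⟨m, hm, h⟩
    exact ⟨m, hm, a - m, Ideal.Quotient.eq.mp h.symm, by ring⟩
  · rintro ⟨m, hm, i, hi, rfl⟩
    exact ⟨m, hm, (Ideal.Quotient.eq.mpr (by simpa using hi)).symm⟩

/-- An ideal `K` disjoint from `M + I` extends to a prime ideal containing `I` and
disjoint from `M`. -/
theorem Ideal.exists_prime_of_disjoint_addIdeal {A : Type*} [CommRing A] {M : Submonoid A}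
    {I K : Ideal A} (h : ∀ a ∈ M.addIdeal I, a ∉ K) :
    ∃ P : Ideal A, P.IsPrime ∧ K ≤ P ∧ I ≤ P ∧ ∀ m ∈ M, m ∉ P := by
  have hdisj : Disjoint ((K ⊔ I : Ideal A) : Set A) M := by
    rw [Set.disjoint_left]
    intro a ha haM
    obtain ⟨k, hk, i, hi, rfl⟩ := Submodule.mem_sup.mp ha
    exact h k (Submonoid.mem_addIdeal.mpr ⟨k + i, haM, -i, I.neg_mem hi, by ring⟩) hk
  obtain ⟨P, hP, hle, hPM⟩ := Ideal.exists_le_prime_disjoint (K ⊔ I) M hdisj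
  exact ⟨P, hP, le_sup_left.trans hle, le_sup_right.trans hle,
    fun m hm hmP => Set.disjoint_left.mp hPM hmP hm⟩

/-- The submonoid of all nested values of an idealistic chain of length `ℓ`. -/
def chainSubmonoid {A : Type*} [CommRing A] (J U : ℕ → Set A) : ℕ → Submonoid A
  | 0 => (Submonoid.closure (U 0)).addIdeal (Ideal.span (J 0))
  | n + 1 => (Submonoid.closure (U 0) ⊔
      chainSubmonoid (fun i => J (i + 1)) (fun i => U (i + 1)) n).addIdeal (Ideal.span (J 0))

theorem exists_chainVal_of_mem_chainSubmonoid {A : Type*} [CommRing A] {J U : ℕ → Set A} {ℓ : ℕ}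
    {a : A} (ha : a ∈ chainSubmonoid J U ℓ) :
    ∃ j u : ℕ → A, (∀ i ≤ ℓ, j i ∈ Ideal.span (J i)) ∧
      (∀ i ≤ ℓ, u i ∈ Submonoid.closure (U i)) ∧ chainVal u j ℓ = a := by
  induction ℓ generalizing J U a with
  | zero =>
    obtain ⟨m, hm, i, hi, rfl⟩ := Submonoid.mem_addIdeal.mp ha
    refine ⟨fun _ => i, fun _ => m, fun k hk => ?_, fun k hk => ?_, rfl⟩ <;>
      obtain rfl := Nat.le_zero.mp hk <;> assumption
  | succ n ih =>
    obtain ⟨m, hm, i, hi, rfl⟩ := Submonoid.mem_addIdeal.mp ha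
    obtain ⟨x, hx, v, hv, rfl⟩ := Submonoid.mem_sup.mp hm
    obtain ⟨j, u, hj, hu, rfl⟩ := ih hv
    refine ⟨fun k => Nat.casesOn k i j, fun k => Nat.casesOn k x u, ?_, ?_, rfl⟩
    · rintro (_ | k) hk
      · exact hi
      · exact hj k (Nat.le_of_succ_le_succ hk)
    · rintro (_ | k) hk
      · exact hx
      · exact hu k (Nat.le_of_succ_le_succ hk)

theorem exists_prime_chain_of_disjoint_chainSubmonoid {A : Type*} [CommRing A] {J U : ℕ → Set A}
    {ℓ : ℕ} {K : Ideal A} (h : ∀ a ∈ chainSubmonoid J U ℓ, a ∉ K) :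
    ∃ P : ℕ → Ideal A, K ≤ P 0 ∧ (∀ i ≤ ℓ, (P i).IsPrime) ∧
      (∀ i k, i ≤ k → k ≤ ℓ → P i ≤ P k) ∧
      (∀ i ≤ ℓ, J i ⊆ (P i : Set A)) ∧
      (∀ i ≤ ℓ, U i ∩ (P i : Set A) = ∅) := by
  induction ℓ generalizing J U K with
  | zero =>
    obtain ⟨P, hP, hK, hJ, hU⟩ := Ideal.exists_prime_of_disjoint_addIdeal h
    refine ⟨fun _ => P, hK, fun _ _ => hP, fun _ _ _ _ => le_rfl, fun i hi => ?_, fun i hi => ?_⟩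
    · obtain rfl := Nat.le_zero.mp hi
      exact Ideal.span_le.mp hJ
    · obtain rfl := Nat.le_zero.mp hi
      exact Set.disjoint_iff_inter_eq_empty.mp
        (Set.disjoint_left.mpr fun a ha => hU a (Submonoid.subset_closure ha))
  | succ n ih =>
    obtain ⟨P, hP, hK, hJ, hU⟩ := Ideal.exists_prime_of_disjoint_addIdeal h
    obtain ⟨Q, hPQ, hQ, hmono, hQJ, hQU⟩ :=
      ih fun a ha => hU a (le_sup_right (a := Submonoid.closure (U 0)) ha)
    refine ⟨fun k => Nat.casesOn k P Q, hK, ?_, ?_, ?_, ?_⟩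
    · rintro (_ | k) hk
      · exact hP
      · exact hQ k (Nat.le_of_succ_le_succ hk)
    · rintro (_ | i) (_ | k) hik hk
      · exact le_rfl
      · exact hPQ.trans (hmono 0 k k.zero_le (Nat.le_of_succ_le_succ hk))
      · exact absurd hik (Nat.not_succ_le_zero i)
      · exact hmono i k (Nat.le_of_succ_le_succ hik) (Nat.le_of_succ_le_succ hk)
    · rintro (_ | k) hk
      · exact Ideal.span_le.mp hJ
      · exact hQJ k (Nat.le_of_succ_le_succ hk)
    · rintro (_ | k) hk
      · exact Set.disjoint_iff_inter_eq_empty.mp (Set.disjoint_left.mpr fun a ha =>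
          hU a (le_sup_left (a := Submonoid.closure (U 0)) (Submonoid.subset_closure ha)))
      · exact hQU k (Nat.le_of_succ_le_succ hk)

theorem chainVal_notMem_of_prime_chain {A : Type*} [CommRing A] {P : ℕ → Ideal A} {ℓ : ℕ}
    (hP : ∀ i ≤ ℓ, (P i).IsPrime) (hmono : ∀ i k, i ≤ k → k ≤ ℓ → P i ≤ P k) {u j : ℕ → A}
    (hj : ∀ i ≤ ℓ, j i ∈ P i) (hu : ∀ i ≤ ℓ, u i ∉ P i) : chainVal u j ℓ ∉ P 0 := by
  induction ℓ generalizing P u j with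
  | zero =>
    intro h
    exact hu 0 le_rfl (((P 0).add_mem_iff_left (hj 0 le_rfl)).mp h)
  | succ n ih =>
    intro h
    have hmul := ((P 0).add_mem_iff_left (hj 0 (Nat.zero_le _))).mp h
    rcases (hP 0 (Nat.zero_le _)).mem_or_mem hmul with h0 | h1
    · exact hu 0 (Nat.zero_le _) h0
    · exact ih (P := fun i => P (i + 1)) (fun i hi => hP _ (Nat.succ_le_succ hi))
        (fun i k hik hk => hmono _ _ (Nat.succ_le_succ hik) (Nat.succ_le_succ hk))
        (fun i hi => hj _ (Nat.succ_le_succ hi)) (fun i hi => hu _ (Nat.succ_le_succ hi))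
        (hmono 0 1 (Nat.zero_le _) (Nat.succ_le_succ n.zero_le) h1)

/-- Formal Nullstellensatz for idealistic chains: there is an increasing chain
of prime ideals `P₀ ⊆ ⋯ ⊆ P_ℓ` refining `((J₀,U₀),…,(J_ℓ,U_ℓ))` if and only
if the chain does not collapse. -/
theorem formal_nullstellensatz_chains {A : Type*} [CommRing A]
    (J U : ℕ → Set A) (ℓ : ℕ) :
    (∃ P : ℕ → Ideal A, (∀ i ≤ ℓ, (P i).IsPrime) ∧
      (∀ i k, i ≤ k → k ≤ ℓ → P i ≤ P k) ∧
      (∀ i ≤ ℓ, J i ⊆ (P i : Set A)) ∧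
      (∀ i ≤ ℓ, U i ∩ (P i : Set A) = ∅)) ↔
    ¬ ChainCollapses J U ℓ := by
  constructor
  · rintro ⟨P, hP, hmono, hJ, hU⟩ ⟨j, u, hj, hu, h0⟩
    refine chainVal_notMem_of_prime_chain hP hmono
      (fun i hi => Ideal.span_le.mpr (hJ i hi) (hj i hi)) (fun i hi => ?_)
      (h0 ▸ (P 0).zero_mem)
    have := hP i hi
    have hle : Submonoid.closure (U i) ≤ (P i).primeCompl :=
      Submonoid.closure_le.mpr fun a ha haP => (hU i hi).subset ⟨ha, haP⟩
    exact hle (hu i hi)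
  · intro h
    have hbot : ∀ a ∈ chainSubmonoid J U ℓ, a ∉ (⊥ : Ideal A) := by
      rintro a ha ha0
      obtain rfl := Ideal.mem_bot.mp ha0
      exact h (exists_chainVal_of_mem_chainSubmonoid ha)
    obtain ⟨P, -, hP⟩ := exists_prime_chain_of_disjoint_chainSubmonoid hbot
    exact ⟨P, hP⟩
end

section
/- Let A be a commutative ring and n ∈ ℕ. The Krull dimension of A (the Krull dimension of the poset of prime ideals of A, taking value −∞ for the trivial ring) is at most n if and only if every sequence (x₁,…,x_{n+1}) of n+1 elements of A is singular. -/
/-- The nested value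
`x₁^{m₁}·(x₂^{m₂}·(⋯(x_ℓ^{m_ℓ}·(1 + a_ℓ·x_ℓ) + ⋯) + a₂·x₂) + a₁·x₁)`
associated to the sequence `x₁,…,x_ℓ` (the last argument is `ℓ`; the sequence
is indexed starting at `1`). -/
def singVal {A : Type*} [CommRing A] (x a : ℕ → A) (m : ℕ → ℕ) : ℕ → A
  | 0 => 1
  | n + 1 =>
      x 1 ^ m 1 *
        (singVal (fun i => x (i + 1)) (fun i => a (i + 1)) (fun i => m (i + 1)) n + a 1 * x 1)

/-- The sequence `x₁,…,x_ℓ` is singular if there exist `a₁,…,a_ℓ` and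
`m₁,…,m_ℓ` with
`x₁^{m₁}·(x₂^{m₂}·(⋯(x_ℓ^{m_ℓ}·(1 + a_ℓ·x_ℓ) + ⋯) + a₂·x₂) + a₁·x₁) = 0`. -/
def IsSingular {A : Type*} [CommRing A] (x : ℕ → A) (ℓ : ℕ) : Prop :=
  ∃ a : ℕ → A, ∃ m : ℕ → ℕ, singVal x a m ℓ = 0

theorem singVal_congr {A : Type*} [CommRing A] {x a a' : ℕ → A} {m m' : ℕ → ℕ} {ℓ : ℕ}
    (ha : ∀ i, a (i + 1) = a' (i + 1)) (hm : ∀ i, m (i + 1) = m' (i + 1)) :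
    singVal x a m ℓ = singVal x a' m' ℓ := by
  induction ℓ generalizing x a a' m m' with
  | zero => rfl
  | succ ℓ ih =>
    have h := ih (x := fun i => x (i + 1)) (a := fun i => a (i + 1)) (m := fun i => m (i + 1))
      (a' := fun i => a' (i + 1)) (m' := fun i => m' (i + 1))
      (fun i => ha (i + 1)) (fun i => hm (i + 1))
    rw [singVal, singVal, h, show a 1 = a' 1 from ha 0, show m 1 = m' 1 from hm 0]

theorem exists_singVal_succ {A : Type*} [CommRing A] (x a : ℕ → A) (m : ℕ → ℕ) (ℓ : ℕ)
    (c : A) (k : ℕ) :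
    ∃ (a' : ℕ → A) (m' : ℕ → ℕ), singVal x a' m' (ℓ + 1) =
      x 1 ^ k * (singVal (fun i => x (i + 1)) a m ℓ + c * x 1) := by
  refine ⟨fun i => Function.update a 0 c (i - 1), fun i => Function.update m 0 k (i - 1), ?_⟩
  simp only [singVal]
  rw [singVal_congr (a' := a) (m' := m)] <;> simp

/-- The elements of the form `singVal x a m ℓ`, for fixed `x` and `ℓ`, form a submonoid. -/
def singSubmonoid {A : Type*} [CommRing A] (x : ℕ → A) (ℓ : ℕ) : Submonoid A where
  carrier := {s | ∃ (a : ℕ → A) (m : ℕ → ℕ), singVal x a m ℓ = s}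
  one_mem' := by
    induction ℓ generalizing x with
    | zero => exact ⟨0, 0, rfl⟩
    | succ ℓ ih =>
      obtain ⟨a, m, h⟩ := ih fun i => x (i + 1)
      obtain ⟨a', m', h'⟩ := exists_singVal_succ x a m ℓ 0 0
      exact ⟨a', m', by simp [h', h]⟩
  mul_mem' := by
    rintro _ _ ⟨a, m, rfl⟩ ⟨b, k, rfl⟩
    induction ℓ generalizing x a b m k with
    | zero => exact ⟨0, 0, by simp [singVal]⟩
    | succ ℓ ih =>
      obtain ⟨c, j, h⟩ := ih (fun i => x (i + 1)) (fun i => a (i + 1)) (fun i => m (i + 1))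
        (fun i => b (i + 1)) (fun i => k (i + 1))
      set s := singVal (fun i => x (i + 1)) (fun i => a (i + 1)) (fun i => m (i + 1)) ℓ
      set t := singVal (fun i => x (i + 1)) (fun i => b (i + 1)) (fun i => k (i + 1)) ℓ
      obtain ⟨c', j', h'⟩ := exists_singVal_succ x c j ℓ
        (s * b 1 + t * a 1 + a 1 * b 1 * x 1) (m 1 + k 1)
      exact ⟨c', j', by rw [h', h, singVal, singVal]; ring⟩

theorem mem_singSubmonoid_succ {A : Type*} [CommRing A] {x : ℕ → A} {ℓ : ℕ} {s : A}
    (hs : s ∈ singSubmonoid (fun i => x (i + 1)) ℓ) (c : A) (k : ℕ) :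
    x 1 ^ k * (s + c * x 1) ∈ singSubmonoid x (ℓ + 1) := by
  obtain ⟨a, m, rfl⟩ := hs
  exact exists_singVal_succ x a m ℓ c k

/-- An ideal disjoint from `singSubmonoid x ℓ` is contained in the first term of a chain of
primes of length `ℓ`. -/
theorem exists_ltSeries_of_disjoint_singSubmonoid {A : Type*} [CommRing A] (x : ℕ → A) (ℓ : ℕ)
    (I : Ideal A) (hI : Disjoint (I : Set A) (singSubmonoid x ℓ)) :
    ∃ p : LTSeries (PrimeSpectrum A), p.length = ℓ ∧ I ≤ p.head.asIdeal := by
  induction ℓ generalizing x I with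
  | zero =>
    obtain ⟨P, hP, hIP, -⟩ := I.exists_le_prime_disjoint _ hI
    exact ⟨RelSeries.singleton _ ⟨P, hP⟩, rfl, hIP⟩
  | succ ℓ ih =>
    obtain ⟨P, hP, hIP, hdisj⟩ := I.exists_le_prime_disjoint _ hI
    rw [Set.disjoint_left] at hdisj
    have hx : x 1 ∉ P := fun h => hdisj h <| by
      simpa using mem_singSubmonoid_succ (x := x) (one_mem (singSubmonoid _ ℓ)) 0 1
    obtain ⟨p, hp, hle⟩ := ih (fun i => x (i + 1)) (P ⊔ Ideal.span {x 1}) <| by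
      rw [Set.disjoint_left]
      intro s hs hs'
      obtain ⟨y, hy, z, hz, rfl⟩ := Submodule.mem_sup.mp hs
      obtain ⟨c, rfl⟩ := Ideal.mem_span_singleton'.mp hz
      exact hdisj hy (by simpa using mem_singSubmonoid_succ hs' (-c) 0)
    have hlt : (⟨P, hP⟩ : PrimeSpectrum A) < p.head :=
      (PrimeSpectrum.asIdeal_lt_asIdeal _ _).mp <| SetLike.lt_iff_le_and_exists.mpr
        ⟨le_sup_left.trans hle, x 1,
          hle (Ideal.mem_sup_right (Ideal.mem_span_singleton_self _)), hx⟩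
    exact ⟨p.cons ⟨P, hP⟩ hlt, by simp [hp], by simpa using hIP⟩

theorem singVal_notMem {A : Type*} [CommRing A] (x a : ℕ → A) (m : ℕ → ℕ) (ℓ : ℕ)
    (p : ℕ → PrimeSpectrum A) (hp : Monotone p)
    (hx : ∀ i < ℓ, x (i + 1) ∈ (p (i + 1)).asIdeal ∧ x (i + 1) ∉ (p i).asIdeal) :
    singVal x a m ℓ ∉ (p 0).asIdeal := by
  induction ℓ generalizing x a m p with
  | zero => exact (Ideal.ne_top_iff_one _).mp (p 0).isPrime.ne_top
  | succ ℓ ih =>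
    intro h
    obtain ⟨hx₁, hx₀⟩ := hx 0 ℓ.succ_pos
    have h₀ := ((p 0).isPrime.mem_or_mem h).resolve_left
      fun h => hx₀ ((p 0).isPrime.mem_of_pow_mem _ h)
    refine ih (fun i => x (i + 1)) (fun i => a (i + 1)) (fun i => m (i + 1))
      (fun i => p (i + 1)) (fun i j hij => hp (by lia)) (fun i hi => hx (i + 1) (by lia)) ?_
    exact (Ideal.add_mem_iff_left _ (Ideal.mul_mem_left _ _ hx₁)).mp (hp zero_le_one h₀)

/-- The Krull dimension of a commutative ring `A` is `≤ n` iff every sequence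
of `n+1` elements of `A` is singular. -/
theorem ringKrullDim_le_iff_singular {A : Type*} [CommRing A] (n : ℕ) :
    ringKrullDim A ≤ n ↔ ∀ x : ℕ → A, IsSingular x (n + 1) := by
  constructor
  · intro hdim x
    by_contra hsing
    obtain ⟨p, hp, -⟩ := exists_ltSeries_of_disjoint_singSubmonoid x (n + 1) ⊥ <| by
      rw [Set.disjoint_left]
      intro s hs hs'
      obtain rfl : s = 0 := hs
      exact hsing hs'
    have h : ((n + 1 : ℕ) : WithBot ℕ∞) ≤ n :=
      hp ▸ (Order.LTSeries.length_le_krullDim p).trans hdim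
    exact absurd (Nat.cast_le.mp h) (by lia)
  · intro hsing
    by_contra! hdim
    have hdim' : ((n + 1 : ℕ) : WithBot ℕ∞) ≤ ringKrullDim A := by
      exact_mod_cast ENat.WithBot.add_one_le_iff.mpr hdim
    obtain ⟨l, hl⟩ := Order.le_krullDim_iff.mp hdim'
    let p : ℕ → PrimeSpectrum A := fun i => l ⟨min i (n + 1), by lia⟩
    have hlt (i : ℕ) (hi : i < n + 1) : p i < p (i + 1) :=
      l.strictMono (Fin.mk_lt_mk.mpr (by lia))
    choose! y hy hy' using fun i hi => (SetLike.lt_iff_le_and_exists.mp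
      ((PrimeSpectrum.asIdeal_lt_asIdeal _ _).mpr (hlt i hi))).2
    obtain ⟨a, m, h⟩ := hsing fun i => y (i - 1)
    refine singVal_notMem _ a m (n + 1) p
      (fun i j hij => l.monotone (Fin.mk_le_mk.mpr (by lia))) (fun i hi => ?_)
      (h ▸ zero_mem _)
    exact ⟨hy i hi, hy' i hi⟩
end
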